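/- arXiv:2511.10422 — 7 statements merged into one kernel-verified Lean document; each statement's English description precedes it below -/
import Mathlib

section
/- For all nonzero integers r, s, t, there exists a sequence q : ℕ → ℚ such that (i) for every n, q n ≠ (r + t)/(r*s*t); (ii) the sequence of real numbers (q n : ℝ) tends to (r + t)/(r*s*t) as n → ∞; and (iii) for every n, the group homomorphism φ_{q n} : FreeGroup Bool →* SL(2,ℝ) is not injective (i.e. A and B (q n) do not freely generate a free group). In other words, every number of the form (r+t)/(rst) is the limit of a non-constant sequence of non-free rational numbers. -/
abbrev SL2R := Matrix.SpecialLinearGroup (Fin 2) ℝ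

/-- The matrix `A = [[1,1],[0,1]]` in `SL(2,ℝ)`. -/
def A : SL2R := ⟨!![1,1;0,1], by norm_num [Matrix.det_fin_two_of]⟩

/-- The matrix `B q = [[1,0],[q,1]]` in `SL(2,ℝ)`. -/
def B (q : ℝ) : SL2R := ⟨!![1,0;q,1], by norm_num [Matrix.det_fin_two_of]⟩

/-- The homomorphism sending the generators of the free group on two
generators to `A` and `B q`. -/
def φ (q : ℝ) : FreeGroup Bool →* SL2R :=
  FreeGroup.lift (fun b : Bool => if b then B q else A)

lemma coe_A_zpow (n : ℤ) : ((A ^ n : SL2R) : Matrix (Fin 2) (Fin 2) ℝ) = !![1, (n : ℝ); 0, 1] := by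
  induction n using Int.induction_on with
  | zero => simp [Matrix.one_fin_two]
  | succ n ih =>
    rw [zpow_add_one, Matrix.SpecialLinearGroup.coe_mul, ih]
    simp [A, add_comm]
  | pred n ih =>
    rw [zpow_sub_one, Matrix.SpecialLinearGroup.coe_mul, ih, Matrix.SpecialLinearGroup.coe_inv]
    simp [A, Matrix.adjugate_fin_two_of]
    ring

lemma coe_B_zpow (q : ℝ) (n : ℤ) :
    ((B q ^ n : SL2R) : Matrix (Fin 2) (Fin 2) ℝ) = !![1, 0; n * q, 1] := by
  induction n using Int.induction_on with
  | zero => simp [Matrix.one_fin_two]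
  | succ n ih =>
    rw [zpow_add_one, Matrix.SpecialLinearGroup.coe_mul, ih]
    simp [B, add_mul]
  | pred n ih =>
    rw [zpow_sub_one, Matrix.SpecialLinearGroup.coe_mul, ih, Matrix.SpecialLinearGroup.coe_inv]
    simp [B, Matrix.adjugate_fin_two_of]
    ring

/-- An element `g` of `SL(2,ℝ)` conjugates `A` into the centralizer of `A` iff it fixes `∞`. -/
lemma commute_conj_A_iff (g : SL2R) : Commute (g * A * g⁻¹) A ↔ g 1 0 = 0 := by
  have hdet : g 0 0 * g 1 1 - g 0 1 * g 1 0 = 1 := by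
    rw [← Matrix.det_fin_two]; exact g.det_coe
  have hM : ((g * A * g⁻¹ : SL2R) : Matrix (Fin 2) (Fin 2) ℝ) =
      !![1 - g 0 0 * g 1 0, g 0 0 ^ 2; -g 1 0 ^ 2, 1 + g 0 0 * g 1 0] := by
    rw [Matrix.SpecialLinearGroup.coe_mul, Matrix.SpecialLinearGroup.coe_mul,
      Matrix.SpecialLinearGroup.coe_inv]
    ext i j
    fin_cases i <;> fin_cases j <;>
      simp [A, Matrix.mul_apply, Fin.sum_univ_two, Matrix.adjugate_fin_two] <;>
      first | ring1 | linear_combination hdet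
  constructor
  · intro h
    have h00 := congrArg (fun M : SL2R => (M : Matrix (Fin 2) (Fin 2) ℝ) 0 0) h.eq
    simp only [Matrix.SpecialLinearGroup.coe_mul _ A, Matrix.SpecialLinearGroup.coe_mul A, hM] at h00
    simpa [A, Matrix.mul_apply, Fin.sum_univ_two] using h00
  · intro h
    refine Subtype.ext ?_
    rw [Matrix.SpecialLinearGroup.coe_mul _ A, Matrix.SpecialLinearGroup.coe_mul A, hM]
    simp [A, h, add_comm]

/-- A word fixing `∞` at the parameter `q`, but not at some other parameter `p`,
witnesses that `q` is non-free. -/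
lemma not_injective_of_lower_left {q p : ℝ} (g : FreeGroup Bool)
    (hq : φ q g 1 0 = 0) (hp : φ p g 1 0 ≠ 0) : ¬ Function.Injective (φ q) := by
  intro hinj
  have hA (x : ℝ) : φ x (FreeGroup.of false) = A := by simp [φ]
  have key (x : ℝ) : φ x (g * FreeGroup.of false * g⁻¹) = φ x g * A * (φ x g)⁻¹ := by
    simp [hA]
  have h : Commute (g * FreeGroup.of false * g⁻¹) (FreeGroup.of false) := by
    apply Commute.of_map hinj
    rw [key, hA]
    exact (commute_conj_A_iff _).2 hq
  apply hp
  rw [← commute_conj_A_iff, ← key, ← hA p]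
  exact h.map (φ p)

/-- The word `B ^ r * A ^ (-s) * B ^ t * A ^ n * B ^ k`. -/
def fiveSyllableWord (r s t n k : ℤ) : FreeGroup Bool :=
  FreeGroup.of true ^ r * FreeGroup.of false ^ (-s) * FreeGroup.of true ^ t *
    FreeGroup.of false ^ n * FreeGroup.of true ^ k

lemma φ_fiveSyllableWord_lower_left (q : ℝ) (r s t n k : ℤ) :
    φ q (fiveSyllableWord r s t n k) 1 0 =
      q * ((r + t - r * s * t * q) * (1 + n * k * q) + k * (1 - r * s * q)) := by
  have h : φ q (fiveSyllableWord r s t n k) = B q ^ r * A ^ (-s) * B q ^ t * A ^ n * B q ^ k := by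
    simp [φ, fiveSyllableWord]
  rw [h]
  simp only [Matrix.SpecialLinearGroup.coe_mul, coe_A_zpow, coe_B_zpow]
  simp [Matrix.mul_apply, Fin.sum_univ_two]
  ring

/-- A quadratic polynomial with positive nonsquare leading coefficient and value `R ^ 2` at `0`
takes a square value at some nonzero integer. -/
lemma exists_ne_zero_quadratic_eq_sq {P Q R : ℤ} (hP : 0 < P) (hsq : ¬ IsSquare P) (hR : R ≠ 0) :
    ∃ k y : ℤ, k ≠ 0 ∧ P * k ^ 2 + Q * k + R ^ 2 = y ^ 2 := by
  obtain ⟨a, b, hab, hb⟩ := Pell.exists_of_not_isSquare hP hsq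
  have ha : a ≠ 0 := by
    rintro rfl
    nlinarith [sq_nonneg b, mul_nonneg hP.le (sq_nonneg b)]
  have hval (c : ℤ) (hc : c ^ 2 - P * b ^ 2 = 1) :
      P * (b * (Q * b + 2 * c * R)) ^ 2 + Q * (b * (Q * b + 2 * c * R)) + R ^ 2 =
        (R * (1 + 2 * P * b ^ 2) + Q * c * b) ^ 2 := by
    linear_combination (4 * P * R ^ 2 * b ^ 2 - Q ^ 2 * b ^ 2) * hc
  by_cases h : Q * b + 2 * a * R = 0
  · refine ⟨_, _, mul_ne_zero hb fun h' => ?_, hval (-a) (by rw [neg_sq]; exact hab)⟩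
    exact mul_ne_zero ha hR (by linarith)
  · exact ⟨_, _, mul_ne_zero hb h, hval a hab⟩

lemma not_isSquare_sq_add {X C : ℤ} (hC : C ≠ 0) (hX : |C| < X) : ¬ IsSquare (X ^ 2 + C) := by
  rintro ⟨z, hz⟩
  have hzz : |z| * |z| = X ^ 2 + C := by rw [abs_mul_abs_self, hz]
  obtain ⟨h1, h2⟩ := abs_lt.1 hX
  have hz0 := abs_nonneg z
  rcases lt_trichotomy |z| X with h | h | h
  · nlinarith
  · exact hC (by rw [h] at hzz; linarith)
  · nlinarith

lemma exists_discriminant_eq_sq {r s t : ℤ} (hr : r ≠ 0) (hs : s ≠ 0) (ht : t ≠ 0)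
    (hrt : r + t ≠ 0) : ∃ N : ℕ, ∀ n : ℕ, N ≤ n → ∃ k y : ℤ, k ≠ 0 ∧
      (k * (n * (r + t) - r * s) - r * s * t) ^ 2 + 4 * n * k * (r * s * t) * (r + t + k) =
        y ^ 2 := by
  set C := 4 * r ^ 3 * s ^ 2 * t with hCdef
  have hC : C ≠ 0 := by simp [hCdef, hr, hs, ht]
  refine ⟨(|C| + |r * s * (t - r)|).toNat + 1, fun n hn => ?_⟩
  have hn' : |C| + |r * s * (t - r)| + 1 ≤ n := by omega
  set X := (r + t) ^ 2 * n + r * s * (t - r) with hXdef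
  set P := (n * (r + t) - r * s) ^ 2 + 4 * n * (r * s * t) with hPdef
  have hm : 1 ≤ (r + t) ^ 2 := Int.add_one_le_iff.2 (sq_pos_of_ne_zero hrt)
  have hX : |C| < X := by
    have := neg_abs_le (r * s * (t - r))
    have : (n : ℤ) ≤ (r + t) ^ 2 * n := by nlinarith [Int.natCast_nonneg n]
    linarith
  have hXP : (r + t) ^ 2 * P = X ^ 2 + C := by rw [hXdef, hPdef, hCdef]; ring
  have hP : 0 < P := by
    have := neg_abs_le C
    have := abs_nonneg C
    exact pos_of_mul_pos_right (b := P) (by rw [hXP]; nlinarith) (sq_nonneg (r + t))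
  have hsq : ¬ IsSquare P := fun h =>
    not_isSquare_sq_add hC hX (hXP ▸ (IsSquare.sq (r + t)).mul h)
  obtain ⟨k, y, hk, hky⟩ := exists_ne_zero_quadratic_eq_sq
    (Q := -2 * (r * s * t) * (n * (r + t) - r * s) + 4 * n * (r * s * t) * (r + t)) hP hsq
    (mul_ne_zero (mul_ne_zero hr hs) ht)
  exact ⟨k, y, hk, by rw [← hky, hPdef]; ring⟩

/-- Every number of the form `(r+t)/(rst)` is the limit of a non-constant sequence of
non-free rational numbers. -/
theorem limit_of_nonfree (r s t : ℤ) (hr : r ≠ 0) (hs : s ≠ 0) (ht : t ≠ 0) :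
    ∃ q : ℕ → ℚ,
      (∀ n, q n ≠ ((r : ℚ) + t) / (r * s * t)) ∧
      Filter.Tendsto (fun n => (q n : ℝ)) Filter.atTop
        (nhds (((r : ℝ) + t) / (r * s * t))) ∧
      (∀ n, ¬ Function.Injective (φ (q n))) := by
  by_cases hrt : r + t = 0
  · refine ⟨fun n => 2 / (n + 1), fun n => ?_, ?_, fun n => ?_⟩
    · have : (r : ℚ) + t = 0 := by exact_mod_cast hrt
      rw [this, zero_div]
      positivity
    · have : (r : ℝ) + t = 0 := by exact_mod_cast hrt
      rw [this, zero_div]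
      have h := (tendsto_one_div_add_atTop_nhds_zero_nat (𝕜 := ℝ)).const_mul 2
      rw [mul_zero] at h
      refine h.congr fun n => ?_
      push_cast
      ring
    · apply not_injective_of_lower_left (p := -1) (fiveSyllableWord 1 (n + 1) 1 0 0)
      · rw [φ_fiveSyllableWord_lower_left]
        push_cast
        field_simp
        ring
      · rw [φ_fiveSyllableWord_lower_left]
        push_cast
        have : (0 : ℝ) ≤ n := n.cast_nonneg
        intro h
        linarith
  obtain ⟨N, hN⟩ := exists_discriminant_eq_sq hr hs ht hrt
  choose k y hk hy using fun n : ℕ => hN (n + N + 1) (by omega)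
  have hrR : (r : ℝ) ≠ 0 := by exact_mod_cast hr
  have hsR : (s : ℝ) ≠ 0 := by exact_mod_cast hs
  have htR : (t : ℝ) ≠ 0 := by exact_mod_cast ht
  have hrtR : (r : ℝ) + t ≠ 0 := by exact_mod_cast hrt
  have hkR (n) : (k n : ℝ) ≠ 0 := by exact_mod_cast hk n
  have hnR (n : ℕ) : (n + N + 1 : ℝ) ≠ 0 := by positivity
  have hyR (n : ℕ) : (k n * ((n + N + 1) * (r + t) - r * s) - r * s * t : ℝ) ^ 2 +
      4 * (n + N + 1) * k n * (r * s * t) * (r + t + k n) = (y n : ℝ) ^ 2 := by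
    exact_mod_cast hy n
  -- `w n` is the normalized square root of the discriminant; it tends to `1`.
  let w : ℕ → ℚ := fun n => |(y n : ℚ) / ((n + N + 1) * k n * (r + t))|
  let q : ℕ → ℚ := fun n => ((r + t) - r * s * (1 / (n + N + 1)) -
    r * s * t * (1 / ((n + N + 1) * k n)) + (r + t) * w n) / (2 * (r * s * t))
  let u : ℕ → ℝ := fun n => 1 / (n + N + 1)
  let v : ℕ → ℝ := fun n => 1 / ((n + N + 1) * k n)
  have hu : Filter.Tendsto u Filter.atTop (nhds 0) := by
    refine ((tendsto_one_div_add_atTop_nhds_zero_nat (𝕜 := ℝ)).comp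
      (Filter.tendsto_add_atTop_nat N)).congr fun n => ?_
    simp [u]
  have hv : Filter.Tendsto v Filter.atTop (nhds 0) := by
    refine squeeze_zero_norm (fun n => ?_) hu
    have h1 : (1 : ℝ) ≤ |(k n : ℝ)| := by exact_mod_cast Int.one_le_abs (hk n)
    have h2 : (0 : ℝ) < n + N + 1 := by positivity
    simp only [u, v, Real.norm_eq_abs, abs_div, abs_one, abs_mul, abs_of_pos h2]
    gcongr
    nlinarith
  have hw_sq (n) : (w n : ℝ) ^ 2 = (1 - r * s / (r + t) * u n - r * s * t / (r + t) * v n) ^ 2 +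
      4 * (r * s * t) * ((r + t) * v n + u n) / (r + t) ^ 2 := by
    have := hnR n
    have := hkR n
    simp only [w, u, v]
    push_cast
    rw [sq_abs, div_pow, ← hyR]
    field_simp
  have hw : Filter.Tendsto (fun n => (w n : ℝ)) Filter.atTop (nhds 1) := by
    have h1 : Filter.Tendsto (fun n => (w n : ℝ) ^ 2) Filter.atTop (nhds 1) := by
      simp only [hw_sq]
      have := (((hu.const_mul (r * s / (r + t) : ℝ)).const_sub 1).sub
        (hv.const_mul (r * s * t / (r + t) : ℝ))).pow 2 |>.add
        ((((hv.const_mul (r + t : ℝ)).add hu).const_mul (4 * (r * s * t) : ℝ)).div_const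
          ((r + t : ℝ) ^ 2))
      simpa using this
    have h2 := h1.sqrt
    rw [Real.sqrt_one] at h2
    refine h2.congr fun n => Real.sqrt_sq ?_
    exact_mod_cast abs_nonneg _
  have hq (n) : (q n : ℝ) = ((r + t) - r * s * u n - r * s * t * v n + (r + t) * w n) /
      (2 * (r * s * t)) := by
    simp only [q, u, v]
    push_cast
    rfl
  have hroot (n) : ((r : ℝ) + t - r * s * t * q n) * (1 + (n + N + 1) * k n * q n) +
      k n * (1 - r * s * q n) = 0 := by
    have h1 := hw_sq n
    have := hnR n
    have := hkR n
    have hw2 : (w n : ℝ) ^ 2 * ((n + N + 1) * k n * (r + t)) ^ 2 = (y n : ℝ) ^ 2 := by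
      simp only [w]
      push_cast
      rw [sq_abs]
      field_simp
    rw [← hyR] at hw2
    rw [hq]
    simp only [u, v]
    field_simp
    linear_combination -hw2
  have hroot_ne (n : ℕ) {x : ℝ} (hx : x = (r + t) / (r * s * t)) :
      ((r : ℝ) + t - r * s * t * x) * (1 + (n + N + 1) * k n * x) +
        k n * (1 - r * s * x) ≠ 0 := by
    have h1 : (r : ℝ) + t - r * s * t * x = 0 := by rw [hx]; field_simp; ring
    have h2 : 1 - r * s * x = -(r / t : ℝ) := by rw [hx]; field_simp; ring
    rw [h1, h2, zero_mul, zero_add]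
    exact mul_ne_zero (hkR n) (neg_ne_zero.2 (div_ne_zero hrR htR))
  refine ⟨q, fun n h => hroot_ne n (x := q n) (by rw [h]; push_cast; rfl) (hroot n), ?_,
    fun n => ?_⟩
  · simp only [hq]
    have := ((((hu.const_mul (r * s : ℝ)).const_sub (r + t : ℝ)).sub
      (hv.const_mul (r * s * t : ℝ))).add (hw.const_mul (r + t : ℝ))).div_const
      (2 * (r * s * t : ℝ))
    convert this using 2
    field_simp
    ring
  · apply not_injective_of_lower_left (p := (r + t) / (r * s * t))
      (fiveSyllableWord r s t (n + N + 1) (k n))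
    · rw [φ_fiveSyllableWord_lower_left]
      push_cast
      rw [hroot, mul_zero]
    · rw [φ_fiveSyllableWord_lower_left]
      push_cast
      exact mul_ne_zero (by positivity) (hroot_ne n rfl)
end

section
/- (Half-relation symmetry, length 6.) Let q : ℝ and let a₁, a₂, a₃, a₄, a₅, a₆ be nonzero integers. Set M := A^{a₁} * (B q)^{a₂} * A^{a₃} * (B q)^{a₄} * A^{a₅} * (B q)^{a₆} in SL(2,ℝ). If M 0 0 = M 1 1, then A^{a₁} * (B q)^{a₂} * A^{a₃} * (B q)^{a₄} * A^{a₅} * (B q)^{a₆} = (B q)^{a₆} * A^{a₅} * (B q)^{a₄} * A^{a₃} * (B q)^{a₂} * A^{a₁}. -/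
/-- The matrix obtained from `M` by exchanging its two diagonal entries. -/
def swapDiag (M : SL2R) : SL2R :=
  ⟨!![M 1 1, M 0 1; M 1 0, M 0 0], by
    have h := M.det_coe
    rw [Matrix.det_fin_two] at h
    rw [Matrix.det_fin_two_of]
    linarith⟩

theorem coe_swapDiag (M : SL2R) :
    (swapDiag M : Matrix (Fin 2) (Fin 2) ℝ) = !![M 1 1, M 0 1; M 1 0, M 0 0] :=
  rfl

theorem swapDiag_mul (M N : SL2R) : swapDiag (M * N) = swapDiag N * swapDiag M := by
  ext i j
  fin_cases i <;> fin_cases j <;>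
    simp [coe_swapDiag, Matrix.mul_apply, Fin.sum_univ_two] <;> ring

theorem swapDiag_eq_self {M : SL2R} (h : M 0 0 = M 1 1) : swapDiag M = M := by
  ext i j
  fin_cases i <;> fin_cases j <;> simp [coe_swapDiag, h]

/-- Exchanging the diagonal entries, as an anti-endomorphism of `SL(2,ℝ)`. -/
def swapDiagHom : SL2R →* SL2Rᵐᵒᵖ where
  toFun M := MulOpposite.op (swapDiag M)
  map_one' := congrArg MulOpposite.op (swapDiag_eq_self (by simp))
  map_mul' M N := congrArg MulOpposite.op (swapDiag_mul M N)

theorem swapDiagHom_eq_op_self {M : SL2R} (h : M 0 0 = M 1 1) :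
    swapDiagHom M = MulOpposite.op M :=
  congrArg MulOpposite.op (swapDiag_eq_self h)

theorem swapDiagHom_A : swapDiagHom A = MulOpposite.op A :=
  swapDiagHom_eq_op_self (by simp [A])

theorem swapDiagHom_B (q : ℝ) : swapDiagHom (B q) = MulOpposite.op (B q) :=
  swapDiagHom_eq_op_self (by simp [B])

/-- Half-relation symmetry, length 6. -/
theorem half_relation_symm_six (q : ℝ) (a₁ a₂ a₃ a₄ a₅ a₆ : ℤ)
    (h₁ : a₁ ≠ 0) (h₂ : a₂ ≠ 0) (h₃ : a₃ ≠ 0) (h₄ : a₄ ≠ 0) (h₅ : a₅ ≠ 0) (h₆ : a₆ ≠ 0)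
    (h : (A ^ a₁ * (B q) ^ a₂ * A ^ a₃ * (B q) ^ a₄ * A ^ a₅ * (B q) ^ a₆) 0 0
        = (A ^ a₁ * (B q) ^ a₂ * A ^ a₃ * (B q) ^ a₄ * A ^ a₅ * (B q) ^ a₆) 1 1) :
    A ^ a₁ * (B q) ^ a₂ * A ^ a₃ * (B q) ^ a₄ * A ^ a₅ * (B q) ^ a₆
      = (B q) ^ a₆ * A ^ a₅ * (B q) ^ a₄ * A ^ a₃ * (B q) ^ a₂ * A ^ a₁ := by
  apply MulOpposite.op_injective
  rw [← swapDiagHom_eq_op_self h]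
  simp only [map_mul, map_zpow, swapDiagHom_A, swapDiagHom_B, MulOpposite.op_mul,
    MulOpposite.op_zpow, mul_assoc]
end

section
/- (Square-discriminant lemma.) For all nonzero integers a₃, a₄, a₅, the set of integers a₂ with the following property is infinite: the set of integers a₁ such that there exists y : ℤ with c₁² - 4*c₀*c₂ = y² is infinite, where c₂ := a₁*a₂*a₃*a₄*a₅, c₁ := a₁*a₂*a₃ - a₂*a₃*a₄ + a₁*a₂*a₅ + a₁*a₄*a₅ + a₃*a₄*a₅, and c₀ := a₁ - a₂ + a₃ - a₄ + a₅. (Equivalently: for infinitely many a₂, the discriminant of the length-5 half-relation polynomial P⁵_HR(a₁,…,a₅;q) = c₂q² + c₁q + c₀ is a perfect square for infinitely many a₁.) -/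
/-- A set of integers with elements of arbitrarily large absolute value is infinite. -/
theorem Int.infinite_of_forall_exists_le_abs {s : Set ℤ}
    (h : ∀ N : ℤ, ∃ x ∈ s, N ≤ |x|) : s.Infinite := by
  refine Set.Infinite.of_image (fun x : ℤ => |x|) (Set.infinite_of_forall_exists_gt fun N => ?_)
  obtain ⟨x, hx, hN⟩ := h (N + 1)
  exact ⟨|x|, ⟨x, hx, rfl⟩, by lia⟩

/-- Pell's equation for a positive nonsquare has solutions with `y` arbitrarily large. -/
theorem Pell.exists_pos_le_of_not_isSquare {d : ℤ} (h₀ : 0 < d) (hd : ¬IsSquare d) (N : ℤ) :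
    ∃ x y : ℤ, x ^ 2 - d * y ^ 2 = 1 ∧ 0 < y ∧ N ≤ y := by
  obtain ⟨M, hM, hNM⟩ : ∃ M : ℤ, 0 < M ∧ N ≤ M := ⟨max N 1, by lia, by lia⟩
  have hdM : ¬IsSquare (d * M ^ 2) := by
    rintro ⟨z, hz⟩
    obtain ⟨w, rfl⟩ : M ∣ z :=
      (Int.pow_dvd_pow_iff two_ne_zero).1 ⟨d, by linear_combination -hz⟩
    refine hd ⟨w, mul_right_cancel₀ (pow_ne_zero 2 hM.ne') ?_⟩
    linear_combination hz
  obtain ⟨x, y, hxy, hy⟩ := Pell.exists_of_not_isSquare (by positivity) hdM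
  have hy' : 0 < |y| := abs_pos.2 hy
  refine ⟨x, M * |y|, ?_, by positivity, by nlinarith⟩
  rw [mul_pow, sq_abs]
  linear_combination hxy

/-- A quadratic polynomial with positive nonsquare leading coefficient and nonzero square
constant coefficient takes infinitely many square values: if `r ^ 2 - A * q ^ 2 = 1`, the line of
slope `r / q` through `(0, β)` meets the conic again in an integral point. -/
theorem Int.infinite_quadratic_eq_sq {A B β : ℤ} (hA : 0 < A) (hA' : ¬IsSquare A)
    (hβ : β ≠ 0) : {x : ℤ | ∃ y : ℤ, A * x ^ 2 + B * x + β ^ 2 = y ^ 2}.Infinite := by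
  refine Int.infinite_of_forall_exists_le_abs fun N => ?_
  obtain ⟨r, q, hrq, hq, hN⟩ := Pell.exists_pos_le_of_not_isSquare hA hA' N
  have key : ∀ s : ℤ, s ^ 2 - A * q ^ 2 = 1 → q * (B * q - 2 * β * s) ∈
      {x : ℤ | ∃ y : ℤ, A * x ^ 2 + B * x + β ^ 2 = y ^ 2} := fun s hs =>
    ⟨β + s * (B * q - 2 * β * s), by
      linear_combination (-(B * q - 2 * β * s) ^ 2) * hs⟩
  have hr : r ≠ 0 := by
    rintro rfl
    nlinarith [mul_pos hA (pow_pos hq 2)]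
  have hβr : β * r ≠ 0 := mul_ne_zero hβ hr
  have hlarge : 1 ≤ |B * q - 2 * β * r| ∨ 1 ≤ |B * q - 2 * β * (-r)| := by
    by_contra! h
    have h₁ := Int.abs_lt_one_iff.1 h.1
    have h₂ := Int.abs_lt_one_iff.1 h.2
    exact hβr (by linarith)
  rcases hlarge with h | h
  · refine ⟨_, key r hrq, ?_⟩
    rw [abs_mul, abs_of_pos hq]
    nlinarith
  · refine ⟨_, key (-r) (by linear_combination hrq), ?_⟩
    rw [abs_mul, abs_of_pos hq]
    nlinarith

/-- If two squares differ by a nonzero integer `c`, the smaller root is at most `|c|`. -/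
theorem Int.le_abs_of_sq_sub_sq_eq {u v c : ℤ} (hc : c ≠ 0) (h : u ^ 2 - v ^ 2 = c) :
    v ≤ |c| := by
  by_contra! hlt
  have hv : 0 < v := (abs_nonneg c).trans_lt hlt
  have hu := abs_nonneg u
  rw [← sq_abs u] at h
  rcases lt_trichotomy |u| v with h' | h' | h'
  · nlinarith [neg_abs_le c]
  · exact hc (by rw [← h, h']; ring)
  · nlinarith [le_abs_self c]

/-- The leading coefficient, as a polynomial in `a₁`, of the discriminant of the length-5
half-relation polynomial is a positive nonsquare for arbitrarily large `|a₂|`. -/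
theorem exists_discriminant_leadingCoeff_not_isSquare {a₃ a₄ a₅ : ℤ} (h₃ : a₃ ≠ 0)
    (h₄ : a₄ ≠ 0) (h₅ : a₅ ≠ 0) (N : ℤ) :
    ∃ a₂ : ℤ, N ≤ |a₂| ∧
      0 < (a₂ * a₃ + a₂ * a₅ + a₄ * a₅) ^ 2 - 4 * (a₂ * a₃ * a₄ * a₅) ∧
      ¬IsSquare ((a₂ * a₃ + a₂ * a₅ + a₄ * a₅) ^ 2 - 4 * (a₂ * a₃ * a₄ * a₅)) := by
  by_cases hS : a₃ + a₅ = 0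
  · obtain rfl : a₃ = -a₅ := by lia
    have hU : a₄ * a₅ ≠ 0 := mul_ne_zero h₄ h₅
    have hA : (a₄ * (2 * |N| + 1) * -a₅ + a₄ * (2 * |N| + 1) * a₅ + a₄ * a₅) ^ 2
        - 4 * (a₄ * (2 * |N| + 1) * -a₅ * a₄ * a₅) = (a₄ * a₅) ^ 2 * (8 * |N| + 5) := by ring
    have hN := abs_nonneg N
    refine ⟨a₄ * (2 * |N| + 1), ?_, ?_, ?_⟩
    · rw [abs_mul, abs_of_pos (by positivity : 0 < 2 * |N| + 1)]
      nlinarith [Int.one_le_abs h₄, le_abs_self N]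
    · rw [hA]
      positivity
    · rw [hA]
      rintro ⟨z, hz⟩
      obtain ⟨w, rfl⟩ : a₄ * a₅ ∣ z :=
        (Int.pow_dvd_pow_iff two_ne_zero).1 ⟨8 * |N| + 5, by linear_combination -hz⟩
      have hw : 8 * |N| + 5 = w * w :=
        mul_left_cancel₀ (pow_ne_zero 2 hU) (by linear_combination hz)
      have hmod : w * w % 8 = 5 := by lia
      have : w % 8 = 0 ∨ w % 8 = 1 ∨ w % 8 = 2 ∨ w % 8 = 3 ∨ w % 8 = 4 ∨ w % 8 = 5 ∨
          w % 8 = 6 ∨ w % 8 = 7 := by lia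
      rcases this with h | h | h | h | h | h | h | h <;> simp [Int.mul_emod, h] at hmod
  · set T := (a₅ - a₃) * (a₄ * a₅) with hT
    set c := 4 * a₃ * a₅ * (a₄ * a₅) ^ 2 with hc
    have hc0 : c ≠ 0 := by positivity
    have hS2 : 0 < (a₃ + a₅) ^ 2 := by positivity
    obtain ⟨a₂, ha₂⟩ : ∃ a₂ : ℤ, a₂ = |N| + |c| + |T| + 1 := ⟨_, rfl⟩
    have hN := abs_nonneg N
    have hcn := abs_nonneg c
    have hTn := abs_nonneg T
    have hv : |c| < (a₃ + a₅) ^ 2 * a₂ + T := by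
      nlinarith [neg_abs_le T]
    have hA : (a₃ + a₅) ^ 2 *
        ((a₂ * a₃ + a₂ * a₅ + a₄ * a₅) ^ 2 - 4 * (a₂ * a₃ * a₄ * a₅)) =
        ((a₃ + a₅) ^ 2 * a₂ + T) ^ 2 + c := by
      rw [hT, hc]
      ring
    refine ⟨a₂, ?_, ?_, ?_⟩
    · linarith [le_abs_self a₂, le_abs_self N]
    · refine pos_of_mul_pos_right (a := (a₃ + a₅) ^ 2) ?_ hS2.le
      rw [hA]
      nlinarith [neg_abs_le c]
    · rintro ⟨w, hw⟩
      refine hv.not_ge (Int.le_abs_of_sq_sub_sq_eq (u := (a₃ + a₅) * w) hc0 ?_)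
      linear_combination hA - (a₃ + a₅) ^ 2 * hw

/-- Square-discriminant lemma: for all nonzero `a₃, a₄, a₅`, for infinitely many `a₂`,
the discriminant of the length-5 half-relation polynomial is a perfect square for
infinitely many `a₁`. -/
theorem square_discriminant (a₃ a₄ a₅ : ℤ) (h₃ : a₃ ≠ 0) (h₄ : a₄ ≠ 0) (h₅ : a₅ ≠ 0) :
    {a₂ : ℤ | {a₁ : ℤ | ∃ y : ℤ,
        (a₁ * a₂ * a₃ - a₂ * a₃ * a₄ + a₁ * a₂ * a₅ + a₁ * a₄ * a₅ + a₃ * a₄ * a₅) ^ 2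
          - 4 * (a₁ - a₂ + a₃ - a₄ + a₅) * (a₁ * a₂ * a₃ * a₄ * a₅) = y ^ 2}.Infinite
      }.Infinite := by
  refine Int.infinite_of_forall_exists_le_abs fun N => ?_
  obtain ⟨a₂, hN, hA, hA'⟩ :=
    exists_discriminant_leadingCoeff_not_isSquare h₃ h₄ h₅ (max N (|a₅| + 1))
  have hne : a₅ - a₂ ≠ 0 := by
    intro h
    obtain rfl : a₅ = a₂ := by lia
    lia
  refine ⟨a₂, ?_, le_of_max_le_left hN⟩
  have hβ : a₃ * a₄ * (a₅ - a₂) ≠ 0 := by positivity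
  refine (Int.infinite_quadratic_eq_sq hA hA' hβ
    (B := 2 * (a₂ * a₃ + a₂ * a₅ + a₄ * a₅) * (a₃ * a₄ * (a₅ - a₂))
      - 4 * (a₂ * a₃ * a₄ * a₅) * (a₃ + a₅ - a₂ - a₄))).mono ?_
  rintro a₁ ⟨y, hy⟩
  exact ⟨y, by linear_combination hy⟩
end

section
/- Let a₂, a₃, a₄, a₅ be nonzero integers and set α := (a₂*a₃)² + (a₂*a₅)² + (a₄*a₅)² + 2*a₂*a₄*a₅² + 2*a₂²*a₃*a₅ - 2*a₂*a₃*a₄*a₅, assumed to satisfy α > 0. For x : ℝ define c₂ x := x*a₂*a₃*a₄*a₅, c₁ x := x*a₂*a₃ - a₂*a₃*a₄ + x*a₂*a₅ + x*a₄*a₅ + a₃*a₄*a₅, and c₀ x := x - a₂ + a₃ - a₄ + a₅ (integer parameters coerced to ℝ). Then the function x ↦ (-(c₁ x) - Real.sqrt ((c₁ x)² - 4*(c₀ x)*(c₂ x))) / (2 * c₂ x) tends, as x → ∞ (Filter.atTop), to (-(a₂*a₃ + a₂*a₅ + a₄*a₅) - Real.sqrt α) / (2*a₂*a₃*a₄*a₅).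 -/
/-- If the coefficients of a quadratic are affine in `x`, with constant term of leading
coefficient `1` and quadratic coefficient `x * p`, then its smaller root converges as `x → ∞`. -/
theorem tendsto_quadratic_root_of_affine_coeffs (s k m p : ℝ) :
    Filter.Tendsto (fun x : ℝ =>
        (-(x * s + k) - Real.sqrt ((x * s + k) ^ 2 - 4 * (x + m) * (x * p))) / (2 * (x * p)))
      Filter.atTop (nhds ((-s - Real.sqrt (s ^ 2 - 4 * p)) / (2 * p))) := by
  have hcont : Continuous fun y : ℝ =>
      (-(s + k * y) - Real.sqrt ((s + k * y) ^ 2 - 4 * (1 + m * y) * p)) / (2 * p) := by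
    fun_prop
  have hlim := (hcont.tendsto 0).comp tendsto_inv_atTop_zero
  simp only [mul_zero, add_zero, mul_one] at hlim
  refine hlim.congr' ?_
  filter_upwards [Filter.eventually_gt_atTop (0 : ℝ)] with x hx
  have hlin : x * s + k = x * (s + k * x⁻¹) := by field_simp
  have hdisc : (x * s + k) ^ 2 - 4 * (x + m) * (x * p)
      = x ^ 2 * ((s + k * x⁻¹) ^ 2 - 4 * (1 + m * x⁻¹) * p) := by field_simp
  rw [hdisc, Real.sqrt_mul (sq_nonneg x), Real.sqrt_sq hx.le, hlin, ← mul_neg, ← mul_sub,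
    mul_left_comm 2 x p, mul_div_mul_left _ _ hx.ne']
  rfl

/-- The smaller root of the length-5 half-relation polynomial, as a function of `a₁ = x`,
tends to `(-(a₂a₃ + a₂a₅ + a₄a₅) - √α)/(2a₂a₃a₄a₅)` as `x → ∞`. -/
theorem smaller_root_tendsto (a₂ a₃ a₄ a₅ : ℤ)
    (h₂ : a₂ ≠ 0) (h₃ : a₃ ≠ 0) (h₄ : a₄ ≠ 0) (h₅ : a₅ ≠ 0)
    (hα : 0 < (a₂ * a₃) ^ 2 + (a₂ * a₅) ^ 2 + (a₄ * a₅) ^ 2 + 2 * a₂ * a₄ * a₅ ^ 2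
        + 2 * a₂ ^ 2 * a₃ * a₅ - 2 * a₂ * a₃ * a₄ * a₅) :
    Filter.Tendsto (fun x : ℝ =>
        (-(x * a₂ * a₃ - a₂ * a₃ * a₄ + x * a₂ * a₅ + x * a₄ * a₅ + a₃ * a₄ * a₅)
            - Real.sqrt ((x * a₂ * a₃ - a₂ * a₃ * a₄ + x * a₂ * a₅ + x * a₄ * a₅
                  + a₃ * a₄ * a₅) ^ 2
                - 4 * (x - a₂ + a₃ - a₄ + a₅) * (x * a₂ * a₃ * a₄ * a₅)))
          / (2 * (x * a₂ * a₃ * a₄ * a₅)))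
      Filter.atTop
      (nhds ((-((a₂ * a₃ + a₂ * a₅ + a₄ * a₅ : ℤ) : ℝ)
          - Real.sqrt (((a₂ * a₃) ^ 2 + (a₂ * a₅) ^ 2 + (a₄ * a₅) ^ 2 + 2 * a₂ * a₄ * a₅ ^ 2
              + 2 * a₂ ^ 2 * a₃ * a₅ - 2 * a₂ * a₃ * a₄ * a₅ : ℤ) : ℝ))
        / (2 * ((a₂ * a₃ * a₄ * a₅ : ℤ) : ℝ)))) := by
  convert tendsto_quadratic_root_of_affine_coeffs (a₂ * a₃ + a₂ * a₅ + a₄ * a₅)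
    (a₃ * a₄ * a₅ - a₂ * a₃ * a₄) (-a₂ + a₃ - a₄ + a₅) (a₂ * a₃ * a₄ * a₅) using 1
  · ext x
    ring_nf
  · push_cast
    ring_nf
end

section
/- Let k, s, t be positive natural numbers with s ≤ t, and set q := ((k : ℝ) - 1) * ∑_{n ∈ Finset.Icc s t} (k : ℝ)^{-(n : ℤ)}. Set a₁ := 1, a₂ := k^{t-s} * (k^s + k), a₃ := k^{s-1} (natural number expressions). Then (a₁ : ℝ) * a₂ * a₃ * q + a₁ - a₂ + a₃ = 0; i.e. (a₁, a₂, a₃) is a length-3 half-relation for q. -/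
/-- A geometric series over `Finset.Icc` with negative exponents telescopes. -/
theorem sub_one_mul_sum_Icc_zpow_neg {K : Type*} [Field K] {x : K} (hx : x ≠ 0) (m d : ℕ) :
    (x - 1) * ∑ n ∈ Finset.Icc (m + 1) (m + 1 + d), x ^ (-(n : ℤ))
      = (x ^ m)⁻¹ - (x ^ (m + 1 + d))⁻¹ := by
  induction d with
  | zero =>
    simp only [add_zero, Finset.Icc_self, Finset.sum_singleton, zpow_neg, zpow_natCast]
    field_simp
    ring
  | succ d ih =>
    rw [← add_assoc, Finset.sum_Icc_succ_top (by lia), mul_add, ih, zpow_neg, zpow_natCast]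
    field_simp
    ring

/-- The triple `(1, k^{t-s}(k^s + k), k^{s-1})` is a length-3 half-relation for
`q = (k-1) ∑_{n=s}^t k^{-n}`. -/
theorem geom_series_half_relation (k s t : ℕ) (hk : 0 < k) (hs : 0 < s) (ht : 0 < t)
    (hst : s ≤ t) :
    ((1 : ℕ) : ℝ) * ((k ^ (t - s) * (k ^ s + k) : ℕ) : ℝ) * ((k ^ (s - 1) : ℕ) : ℝ)
        * (((k : ℝ) - 1) * ∑ n ∈ Finset.Icc s t, (k : ℝ) ^ (-(n : ℤ)))
      + ((1 : ℕ) : ℝ) - ((k ^ (t - s) * (k ^ s + k) : ℕ) : ℝ) + ((k ^ (s - 1) : ℕ) : ℝ)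
    = 0 := by
  obtain ⟨m, rfl⟩ := Nat.exists_eq_add_of_le' hs
  obtain ⟨d, rfl⟩ := Nat.exists_eq_add_of_le hst
  have hk' : (k : ℝ) ≠ 0 := by exact_mod_cast hk.ne'
  rw [sub_one_mul_sum_Icc_zpow_neg hk', Nat.add_sub_cancel_left, Nat.add_sub_cancel]
  push_cast
  field_simp
  ring
end

section
/- Let k, s, t be positive natural numbers with 2 ≤ s, and set q := ((k : ℝ) - 1) * ∑_{n ∈ Finset.range (t+1)} (k : ℝ)^{-((s : ℤ) + 2*n)}. Set a₁ := k^{s-2}, a₂ := (k^{s-2} + k + 1) * k^{2*t+2}, a₃ := k + 1 (natural number expressions). Then (a₁ : ℝ) * a₂ * a₃ * q + a₁ - a₂ + a₃ = 0; i.e. (a₁, a₂, a₃) is a length-3 half-relation for q. -/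
/-- A finite geometric sum with ratio `x⁻²`, with denominators cleared. -/
theorem pow_mul_sum_zpow_neg_eq {K : Type*} [Field K] {x : K} (hx : x ≠ 0) (r m : ℕ) :
    x ^ r * x ^ (2 * m) * ((x + 1) * ((x - 1) *
      ∑ n ∈ Finset.range m, x ^ (-(((r + 2 : ℕ) : ℤ) + 2 * n)))) = x ^ (2 * m) - 1 := by
  induction m with
  | zero => simp
  | succ m ih =>
    have hterm : x ^ r * x ^ (2 * (m + 1)) * x ^ (-(((r + 2 : ℕ) : ℤ) + 2 * m)) = 1 := by
      rw [← pow_add, ← zpow_natCast, ← zpow_add₀ hx]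
      convert zpow_zero x using 2
      push_cast
      ring
    rw [Finset.sum_range_succ]
    linear_combination x ^ 2 * ih + (x + 1) * (x - 1) * hterm

/-- The triple `(k^{s-2}, (k^{s-2} + k + 1)k^{2t+2}, k + 1)` is a length-3 half-relation for
`q = (k-1) ∑_{n=0}^t k^{-(s+2n)}`. -/
theorem alternating_geom_half_relation (k s t : ℕ) (hk : 0 < k) (ht : 0 < t) (hs : 2 ≤ s) :
    ((k ^ (s - 2) : ℕ) : ℝ) * (((k ^ (s - 2) + k + 1) * k ^ (2 * t + 2) : ℕ) : ℝ)
        * ((k + 1 : ℕ) : ℝ)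
        * (((k : ℝ) - 1) * ∑ n ∈ Finset.range (t + 1), (k : ℝ) ^ (-((s : ℤ) + 2 * n)))
      + ((k ^ (s - 2) : ℕ) : ℝ) - (((k ^ (s - 2) + k + 1) * k ^ (2 * t + 2) : ℕ) : ℝ)
      + ((k + 1 : ℕ) : ℝ)
    = 0 := by
  obtain ⟨r, rfl⟩ := Nat.exists_eq_add_of_le' hs
  have hx : (k : ℝ) ≠ 0 := Nat.cast_ne_zero.mpr hk.ne'
  have hsum := pow_mul_sum_zpow_neg_eq hx r (t + 1)
  rw [Nat.add_sub_cancel, Nat.cast_mul]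
  simp only [Nat.cast_add, Nat.cast_pow, Nat.cast_one] at hsum ⊢
  linear_combination ((k : ℝ) ^ r + k + 1) * hsum
end

section
/- Let H : ℕ → ℤ be the half-companion Pell sequence, i.e. H 0 = 1, H 1 = 1, and H (n+2) = 2 * H (n+1) + H n for all n. Let n ≥ 1, set q := ((H (n+1) : ℝ)) / (H n) and y := (-1)^n * H n * H (n-1) : ℤ. Then the matrix M := A * (B q)^y * A * (B q)⁻¹ * A * (B q)⁻¹ in SL(2,ℝ) satisfies M 0 0 = M 1 1; i.e. (1, y, 1, -1, 1, -1) is a length-6 half-relation for the ratio H_{n+1}/H_n. -/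
theorem B_mul (p q : ℝ) : B p * B q = B (p + q) := by
  ext i j
  rw [Matrix.SpecialLinearGroup.coe_mul]
  fin_cases i <;> fin_cases j <;> simp [B, Matrix.mul_apply, Fin.sum_univ_two]

theorem B_zero : B 0 = 1 := by
  ext i j
  fin_cases i <;> fin_cases j <;> simp [B]

theorem B_inv (q : ℝ) : (B q)⁻¹ = B (-q) := by
  rw [inv_eq_iff_mul_eq_one, B_mul, add_neg_cancel, B_zero]

theorem B_zpow (q : ℝ) (k : ℤ) : B q ^ k = B (k * q) := by
  induction k with
  | zero => simp [B_zero]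
  | succ k ih =>
    rw [zpow_add_one, ih, B_mul]
    congr 1
    push_cast
    ring
  | pred k ih =>
    rw [zpow_sub_one, ih, B_inv, B_mul]
    congr 1
    push_cast
    ring

/-- `(1, y, 1, -1, 1, -1)` is a half-relation for `q` as soon as
`q * (2 * (q - 2) + y * (q ^ 2 - 2 * q - 1)) = 0`. -/
theorem half_relation_of_eq_zero (q : ℝ) (y : ℤ)
    (h : q * (2 * (q - 2) + y * (q ^ 2 - 2 * q - 1)) = 0) :
    (A * B q ^ y * A * (B q)⁻¹ * A * (B q)⁻¹) 0 0
      = (A * B q ^ y * A * (B q)⁻¹ * A * (B q)⁻¹) 1 1 := by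
  rw [B_zpow, B_inv]
  simp only [Matrix.SpecialLinearGroup.coe_mul]
  simp only [A, B, Matrix.mul_fin_two, Matrix.of_apply,
    Matrix.cons_val_zero, Matrix.cons_val_one, Matrix.cons_val', Matrix.cons_val_fin_one]
  linear_combination h

/-- Half-companion Pell numbers are positive. -/
theorem half_companion_pell_pos (H : ℕ → ℤ) (hH0 : H 0 = 1) (hH1 : H 1 = 1)
    (hHrec : ∀ n, H (n + 2) = 2 * H (n + 1) + H n) (n : ℕ) : 0 < H n := by
  induction n using Nat.twoStepInduction with
  | zero => simp [hH0]
  | one => simp [hH1]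
  | more n h₀ h₁ => rw [hHrec]; positivity

/-- The Cassini identity for half-companion Pell numbers. -/
theorem half_companion_pell_cassini (H : ℕ → ℤ) (hH0 : H 0 = 1) (hH1 : H 1 = 1)
    (hHrec : ∀ n, H (n + 2) = 2 * H (n + 1) + H n) (n : ℕ) :
    H (n + 2) * H n - H (n + 1) ^ 2 = 2 * (-1) ^ n := by
  induction n with
  | zero => simp [hHrec, hH0, hH1]
  | succ n ih =>
    rw [hHrec (n + 1), pow_succ]
    linear_combination -ih - H (n + 2) * hHrec n

/-- `(1, y, 1, -1, 1, -1)` with `y = (-1)^n·Hₙ·Hₙ₋₁` is a length-6 half-relation for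
the half-companion Pell ratio `Hₙ₊₁/Hₙ`. -/
theorem half_companion_pell_half_relation (H : ℕ → ℤ)
    (hH0 : H 0 = 1) (hH1 : H 1 = 1)
    (hHrec : ∀ n, H (n + 2) = 2 * H (n + 1) + H n)
    (n : ℕ) (hn : 1 ≤ n) :
    (A * (B ((H (n + 1) : ℝ) / (H n : ℝ))) ^ ((-1 : ℤ) ^ n * H n * H (n - 1))
        * A * (B ((H (n + 1) : ℝ) / (H n : ℝ)))⁻¹
        * A * (B ((H (n + 1) : ℝ) / (H n : ℝ)))⁻¹) 0 0
      = (A * (B ((H (n + 1) : ℝ) / (H n : ℝ))) ^ ((-1 : ℤ) ^ n * H n * H (n - 1))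
        * A * (B ((H (n + 1) : ℝ) / (H n : ℝ)))⁻¹
        * A * (B ((H (n + 1) : ℝ) / (H n : ℝ)))⁻¹) 1 1 := by
  obtain ⟨k, rfl⟩ := Nat.exists_eq_add_of_le' hn
  apply half_relation_of_eq_zero
  have hpos : (H (k + 1) : ℝ) ≠ 0 :=
    mod_cast (half_companion_pell_pos H hH0 hH1 hHrec (k + 1)).ne'
  have hcas : (H (k + 2) : ℝ) * H k - H (k + 1) ^ 2 = 2 * (-1) ^ k :=
    mod_cast half_companion_pell_cassini H hH0 hH1 hHrec k
  have hrec : (H (k + 2) : ℝ) = 2 * H (k + 1) + H k := mod_cast hHrec k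
  have hsign : ((-1 : ℝ) ^ k) ^ 2 = 1 := by rw [← pow_mul, mul_comm, pow_mul]; simp
  rw [Nat.add_sub_cancel, show k + 1 + 1 = k + 2 from rfl]
  push_cast
  rw [pow_succ]
  refine mul_eq_zero_of_right _ ?_
  rw [hrec] at hcas ⊢
  field_simp
  linear_combination -(H k : ℝ) * (-1) ^ k * hcas - 2 * (H k : ℝ) * hsign
end
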